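/- Let N₁ = span_ℝ{[J_k, J_l] : k < l, k, l ∈ {1,2,3,5,6,7}} and let Y = (y₁,…,y₈) ∈ ℝ⁸ with y₁ ≠ 0. If the linear subspace {B·Y : B ∈ N₁} of ℝ⁸ has dimension strictly less than 7, then y₁² + y₂² + y₃² + y₄² = y₅² + y₆² + y₇² + y₈² and y₁y₆ + y₃y₈ = y₂y₇ + y₄y₅. -/

import Mathlib

open Matrix

noncomputable section

/-- The Clifford map `J_{Z₁}` of the pseudo H-type Lie algebra `n_{3,4}`. -/
def J1 : Matrix (Fin 8) (Fin 8) ℝ :=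
  !![0,-1,0,0,0,0,0,0;
     1,0,0,0,0,0,0,0;
     0,0,0,1,0,0,0,0;
     0,0,-1,0,0,0,0,0;
     0,0,0,0,0,0,0,1;
     0,0,0,0,0,0,1,0;
     0,0,0,0,0,-1,0,0;
     0,0,0,0,-1,0,0,0]

/-- The Clifford map `J_{Z₂}`. -/
def J2 : Matrix (Fin 8) (Fin 8) ℝ :=
  !![0,0,-1,0,0,0,0,0;
     0,0,0,-1,0,0,0,0;
     1,0,0,0,0,0,0,0;
     0,1,0,0,0,0,0,0;
     0,0,0,0,0,0,1,0;
     0,0,0,0,0,0,0,-1;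
     0,0,0,0,-1,0,0,0;
     0,0,0,0,0,1,0,0]

/-- The Clifford map `J_{Z₃}`. -/
def J3 : Matrix (Fin 8) (Fin 8) ℝ :=
  !![0,0,0,-1,0,0,0,0;
     0,0,1,0,0,0,0,0;
     0,-1,0,0,0,0,0,0;
     1,0,0,0,0,0,0,0;
     0,0,0,0,0,1,0,0;
     0,0,0,0,-1,0,0,0;
     0,0,0,0,0,0,0,1;
     0,0,0,0,0,0,-1,0]

/-- The Clifford map `J_{Z₄}`. -/
def J4 : Matrix (Fin 8) (Fin 8) ℝ :=
  !![0,0,0,0,1,0,0,0;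
     0,0,0,0,0,0,0,1;
     0,0,0,0,0,0,1,0;
     0,0,0,0,0,1,0,0;
     1,0,0,0,0,0,0,0;
     0,0,0,1,0,0,0,0;
     0,0,1,0,0,0,0,0;
     0,1,0,0,0,0,0,0]

/-- The Clifford map `J_{Z₅}`. -/
def J5 : Matrix (Fin 8) (Fin 8) ℝ :=
  !![0,0,0,0,0,1,0,0;
     0,0,0,0,0,0,1,0;
     0,0,0,0,0,0,0,-1;
     0,0,0,0,-1,0,0,0;
     0,0,0,-1,0,0,0,0;
     1,0,0,0,0,0,0,0;
     0,1,0,0,0,0,0,0;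
     0,0,-1,0,0,0,0,0]

/-- The Clifford map `J_{Z₆}`. -/
def J6 : Matrix (Fin 8) (Fin 8) ℝ :=
  !![0,0,0,0,0,0,1,0;
     0,0,0,0,0,-1,0,0;
     0,0,0,0,-1,0,0,0;
     0,0,0,0,0,0,0,1;
     0,0,-1,0,0,0,0,0;
     0,-1,0,0,0,0,0,0;
     1,0,0,0,0,0,0,0;
     0,0,0,1,0,0,0,0]

/-- The Clifford map `J_{Z₇}`. -/
def J7 : Matrix (Fin 8) (Fin 8) ℝ :=
  !![0,0,0,0,0,0,0,1;
     0,0,0,0,-1,0,0,0;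
     0,0,0,0,0,1,0,0;
     0,0,0,0,0,0,-1,0;
     0,-1,0,0,0,0,0,0;
     0,0,1,0,0,0,0,0;
     0,0,0,-1,0,0,0,0;
     1,0,0,0,0,0,0,0]

/-- The family `J₁, …, J₇`. -/
def J : Fin 7 → Matrix (Fin 8) (Fin 8) ℝ := ![J1, J2, J3, J4, J5, J6, J7]

/-- `N = span ℝ {[Jᵢ, Jⱼ] : 1 ≤ i < j ≤ 7}`, the normalizer of `V = span {J₁,…,J₇}`
in `so(4,4)`. -/
def NN : Submodule ℝ (Matrix (Fin 8) (Fin 8) ℝ) :=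
  Submodule.span ℝ {M | ∃ i j : Fin 7, i < j ∧ M = J i * J j - J j * J i}

/-- `N₁ = span ℝ {[J_k, J_l] : k < l, k, l ∈ {1,2,3,5,6,7}}` (the commutators not
involving `J₄`). -/
def N1 : Submodule ℝ (Matrix (Fin 8) (Fin 8) ℝ) :=
  Submodule.span ℝ
    {M | ∃ k l : Fin 7, k < l ∧ k ≠ 3 ∧ l ≠ 3 ∧ M = J k * J l - J l * J k}

lemma J1_mv (a b c d e f g h : ℝ) : J1 *ᵥ ![a,b,c,d,e,f,g,h] = ![-b,a,d,-c,h,g,-f,-e] := by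
  ext i; fin_cases i <;> simp [J1, Matrix.mulVec, dotProduct, Fin.sum_univ_succ]

lemma J2_mv (a b c d e f g h : ℝ) : J2 *ᵥ ![a,b,c,d,e,f,g,h] = ![-c,-d,a,b,g,-h,-e,f] := by
  ext i; fin_cases i <;> simp [J2, Matrix.mulVec, dotProduct, Fin.sum_univ_succ]

lemma J3_mv (a b c d e f g h : ℝ) : J3 *ᵥ ![a,b,c,d,e,f,g,h] = ![-d,c,-b,a,f,-e,h,-g] := by
  ext i; fin_cases i <;> simp [J3, Matrix.mulVec, dotProduct, Fin.sum_univ_succ]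

lemma J5_mv (a b c d e f g h : ℝ) : J5 *ᵥ ![a,b,c,d,e,f,g,h] = ![f,g,-h,-e,-d,a,b,-c] := by
  ext i; fin_cases i <;> simp [J5, Matrix.mulVec, dotProduct, Fin.sum_univ_succ]

lemma J6_mv (a b c d e f g h : ℝ) : J6 *ᵥ ![a,b,c,d,e,f,g,h] = ![g,-f,-e,h,-c,-b,a,d] := by
  ext i; fin_cases i <;> simp [J6, Matrix.mulVec, dotProduct, Fin.sum_univ_succ]

lemma J7_mv (a b c d e f g h : ℝ) : J7 *ᵥ ![a,b,c,d,e,f,g,h] = ![h,-e,f,-g,-b,c,-d,a] := by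
  ext i; fin_cases i <;> simp [J7, Matrix.mulVec, dotProduct, Fin.sum_univ_succ]

lemma comm_mem (k l : Fin 7) (h : k < l) (hk : k ≠ 3) (hl : l ≠ 3) (Y : Fin 8 → ℝ) :
    J k *ᵥ (J l *ᵥ Y) - J l *ᵥ (J k *ᵥ Y) ∈
      Submodule.span ℝ {w : Fin 8 → ℝ | ∃ B ∈ N1, w = B.mulVec Y} := by
  apply Submodule.subset_span
  refine ⟨J k * J l - J l * J k, Submodule.subset_span ⟨k, l, h, hk, hl, rfl⟩, ?_⟩
  simp [Matrix.sub_mulVec]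

lemma alg_core (v p q r : Fin 4 → ℝ) (c : ℝ)
    (H : ∀ i j, v i * p j - q i * r j = if i = j then c else 0)
    (a b : Fin 4) (ha : v a ≠ 0) (hb : r b ≠ 0) :
    ∃ t, (∀ i, q i = t * v i) ∧ ∀ i, p i = t * r i := by
  have hc : c ^ 3 = 0 := by
    have h00 := H 0 0
    have h01 := H 0 1
    have h02 := H 0 2
    have h10 := H 1 0
    have h11 := H 1 1
    have h12 := H 1 2
    have h20 := H 2 0
    have h21 := H 2 1
    have h22 := H 2 2
    simp at h00 h01 h02 h10 h11 h12 h20 h21 h22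
    have key : ∀ x0 x1 x2 y0 y1 y2 z0 z1 z2 w0 w1 w2 : ℝ,
      (x0*y0-z0*w0)*((x1*y1-z1*w1)*(x2*y2-z2*w2) - (x1*y2-z1*w2)*(x2*y1-z2*w1))
      - (x0*y1-z0*w1)*((x1*y0-z1*w0)*(x2*y2-z2*w2) - (x1*y2-z1*w2)*(x2*y0-z2*w0))
      + (x0*y2-z0*w2)*((x1*y0-z1*w0)*(x2*y1-z2*w1) - (x1*y1-z1*w1)*(x2*y0-z2*w0)) = 0 := by
      intros; ring
    have := key (v 0) (v 1) (v 2) (p 0) (p 1) (p 2) (q 0) (q 1) (q 2) (r 0) (r 1) (r 2)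
    rw [h00, h01, h02, h10, h11, h12, h20, h21, h22] at this
    linear_combination this
  have hc0 : c = 0 := by simpa using hc
  subst hc0
  have H' : ∀ i j, v i * p j = q i * r j := by
    intro i j
    have := H i j
    simp at this
    linarith
  have hp : ∀ i, p i = q a / v a * r i := by
    intro i
    field_simp
    linear_combination H' a i
  refine ⟨q a / v a, fun i => ?_, hp⟩
  apply mul_right_cancel₀ hb
  rw [← H' i b, hp b]; ring

lemma ann (y0 y1 y2 y3 y4 y5 y6 y7 : ℝ) (F : Module.Dual ℝ (Fin 8 → ℝ))
    (hF : F ∈ (Submodule.span ℝ {w : Fin 8 → ℝ | ∃ B ∈ N1,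
      w = B.mulVec ![y0,y1,y2,y3,y4,y5,y6,y7]}).dualAnnihilator)
    (hv : ∃ a, (![y0+y4,y1+y7,y2+y6,y3+y5] : Fin 4 → ℝ) a ≠ 0)
    (hr : ∃ b, (![y0-y4,y1-y7,y2-y6,y3-y5] : Fin 4 → ℝ) b ≠ 0) :
    ∃ t : ℝ, ∀ w, F w = t * (y0*w 0+y1*w 1+y2*w 2+y3*w 3-y4*w 4-y5*w 5-y6*w 6-y7*w 7) := by
  obtain ⟨a, ha⟩ := hv
  obtain ⟨b, hb⟩ := hr
  rw [Submodule.mem_dualAnnihilator] at hF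
  obtain ⟨g, hg⟩ : ∃ g : Fin 8 → ℝ, ∀ w, F w = w 0 * g 0 + w 1 * g 1 + w 2 * g 2 + w 3 * g 3
      + w 4 * g 4 + w 5 * g 5 + w 6 * g 6 + w 7 * g 7 := by
    refine ⟨fun i => F (fun j => if i = j then 1 else 0), fun w => ?_⟩
    rw [LinearMap.pi_apply_eq_sum_univ F w, Fin.sum_univ_eight]
    simp only [smul_eq_mul]
  have h01 := hF _ (comm_mem 0 1 (by decide) (by decide) (by decide) _)
  have h02 := hF _ (comm_mem 0 2 (by decide) (by decide) (by decide) _)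
  have h04 := hF _ (comm_mem 0 4 (by decide) (by decide) (by decide) _)
  have h05 := hF _ (comm_mem 0 5 (by decide) (by decide) (by decide) _)
  have h06 := hF _ (comm_mem 0 6 (by decide) (by decide) (by decide) _)
  have h12 := hF _ (comm_mem 1 2 (by decide) (by decide) (by decide) _)
  have h14 := hF _ (comm_mem 1 4 (by decide) (by decide) (by decide) _)
  have h15 := hF _ (comm_mem 1 5 (by decide) (by decide) (by decide) _)
  have h16 := hF _ (comm_mem 1 6 (by decide) (by decide) (by decide) _)
  have h24 := hF _ (comm_mem 2 4 (by decide) (by decide) (by decide) _)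
  have h25 := hF _ (comm_mem 2 5 (by decide) (by decide) (by decide) _)
  have h26 := hF _ (comm_mem 2 6 (by decide) (by decide) (by decide) _)
  have h45 := hF _ (comm_mem 4 5 (by decide) (by decide) (by decide) _)
  have h46 := hF _ (comm_mem 4 6 (by decide) (by decide) (by decide) _)
  have h56 := hF _ (comm_mem 5 6 (by decide) (by decide) (by decide) _)
  have e0 : J 0 = J1 := rfl
  have e1 : J 1 = J2 := rfl
  have e2 : J 2 = J3 := rfl
  have e4 : J 4 = J5 := rfl
  have e5 : J 5 = J6 := rfl
  have e6 : J 6 = J7 := rfl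
  simp only [e0,e1,e2,e4,e5,e6,J1_mv,J2_mv,J3_mv,J5_mv,J6_mv,J7_mv,hg] at h01 h02 h04 h05 h06 h12 h14 h15 h16 h24 h25 h26 h45 h46 h56
  simp [-mul_eq_zero] at h01 h02 h04 h05 h06 h12 h14 h15 h16 h24 h25 h26 h45 h46 h56
  generalize g 0 = g0 at *
  generalize g 1 = g1 at *
  generalize g 2 = g2 at *
  generalize g 3 = g3 at *
  generalize g 4 = g4 at *
  generalize g 5 = g5 at *
  generalize g 6 = g6 at *
  generalize g 7 = g7 at *
  obtain ⟨t, hq, hp⟩ := alg_core ![y0+y4,y1+y7,y2+y6,y3+y5] ![g0+g4,g1+g7,g2+g6,g3+g5]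
    ![g0-g4,g1-g7,g2-g6,g3-g5] ![y0-y4,y1-y7,y2-y6,y3-y5]
    ((y0+y4)*(g0+g4)-(g0-g4)*(y0-y4)) (by
      intro i j
      fin_cases i <;> fin_cases j <;> simp <;> linarith) a b ha hb
  have q0 := hq 0
  have q1 := hq 1
  have q2 := hq 2
  have q3 := hq 3
  have p0 := hp 0
  have p1 := hp 1
  have p2 := hp 2
  have p3 := hp 3
  simp at q0 q1 q2 q3 p0 p1 p2 p3
  refine ⟨t, fun w => ?_⟩
  rw [hg]
  have k0 : g0 = t*y0 := by linarith
  have k1 : g1 = t*y1 := by linarith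
  have k2 : g2 = t*y2 := by linarith
  have k3 : g3 = t*y3 := by linarith
  have k4 : g4 = -t*y4 := by linarith
  have k5 : g5 = -t*y5 := by linarith
  have k6 : g6 = -t*y6 := by linarith
  have k7 : g7 = -t*y7 := by linarith
  rw [k0,k1,k2,k3,k4,k5,k6,k7]; ring

lemma rank7 (y0 y1 y2 y3 y4 y5 y6 y7 : ℝ)
    (hdim : Module.finrank ℝ
      (Submodule.span ℝ {w : Fin 8 → ℝ | ∃ B ∈ N1,
        w = B.mulVec ![y0,y1,y2,y3,y4,y5,y6,y7]}) < 7)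
    (hv : ∃ a, (![y0+y4,y1+y7,y2+y6,y3+y5] : Fin 4 → ℝ) a ≠ 0)
    (hr : ∃ b, (![y0-y4,y1-y7,y2-y6,y3-y5] : Fin 4 → ℝ) b ≠ 0) : False := by
  have hA := fun F hF => ann y0 y1 y2 y3 y4 y5 y6 y7 F hF hv hr
  set W := Submodule.span ℝ {w : Fin 8 → ℝ | ∃ B ∈ N1,
        w = B.mulVec ![y0,y1,y2,y3,y4,y5,y6,y7]} with hW
  have h1 := Subspace.finrank_add_finrank_dualAnnihilator_eq W
  have h8 : Module.finrank ℝ (Fin 8 → ℝ) = 8 := by simp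
  let P : Fin 8 → Module.Dual ℝ (Fin 8 → ℝ) := fun i => LinearMap.proj i
  let F0 : Module.Dual ℝ (Fin 8 → ℝ) := y0 • P 0 + y1 • P 1 + y2 • P 2 + y3 • P 3
    - y4 • P 4 - y5 • P 5 - y6 • P 6 - y7 • P 7
  have h2 : W.dualAnnihilator ≤ Submodule.span ℝ {F0} := by
    intro F hF
    obtain ⟨t, ht⟩ := hA F hF
    rw [Submodule.mem_span_singleton]
    refine ⟨t, LinearMap.ext fun w => ?_⟩
    rw [ht]
    simp [F0, P]
  have h3 := Submodule.finrank_mono h2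
  have h4 := finrank_span_le_card (R := ℝ) ({F0} : Set (Module.Dual ℝ (Fin 8 → ℝ)))
  simp only [Set.toFinset_singleton, Finset.card_singleton] at h4
  omega

theorem statement5 (Y : Fin 8 → ℝ) (hY : Y 0 ≠ 0)
    (hdim : Module.finrank ℝ
      (Submodule.span ℝ {w : Fin 8 → ℝ | ∃ B ∈ N1, w = B.mulVec Y}) < 7) :
    (Y 0)^2 + (Y 1)^2 + (Y 2)^2 + (Y 3)^2
      = (Y 4)^2 + (Y 5)^2 + (Y 6)^2 + (Y 7)^2 ∧
    Y 0 * Y 5 + Y 2 * Y 7 = Y 1 * Y 6 + Y 3 * Y 4 := by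
  have hYe : Y = ![Y 0, Y 1, Y 2, Y 3, Y 4, Y 5, Y 6, Y 7] := by
    ext i; fin_cases i <;> rfl
  have R := rank7 (Y 0) (Y 1) (Y 2) (Y 3) (Y 4) (Y 5) (Y 6) (Y 7) (by rw [← hYe]; exact hdim)
  by_cases hv : ∃ a, (![Y 0+Y 4,Y 1+Y 7,Y 2+Y 6,Y 3+Y 5] : Fin 4 → ℝ) a ≠ 0
  · have hr := fun h => R hv h
    have z : ∀ b, (![Y 0-Y 4,Y 1-Y 7,Y 2-Y 6,Y 3-Y 5] : Fin 4 → ℝ) b = 0 := by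
      intro b; by_contra h; exact hr ⟨b, h⟩
    have z0 := z 0
    have z1 := z 1
    have z2 := z 2
    have z3 := z 3
    simp at z0 z1 z2 z3
    have a0 : Y 4 = Y 0 := by linarith
    have a1 : Y 7 = Y 1 := by linarith
    have a2 : Y 6 = Y 2 := by linarith
    have a3 : Y 5 = Y 3 := by linarith
    rw [a0, a1, a2, a3]
    constructor <;> ring
  · have z : ∀ b, (![Y 0+Y 4,Y 1+Y 7,Y 2+Y 6,Y 3+Y 5] : Fin 4 → ℝ) b = 0 := by
      intro b; by_contra h; exact hv ⟨b, h⟩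
    have z0 := z 0
    have z1 := z 1
    have z2 := z 2
    have z3 := z 3
    simp at z0 z1 z2 z3
    have a0 : Y 4 = -Y 0 := by linarith
    have a1 : Y 7 = -Y 1 := by linarith
    have a2 : Y 6 = -Y 2 := by linarith
    have a3 : Y 5 = -Y 3 := by linarith
    rw [a0, a1, a2, a3]
    constructor <;> ring

end
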